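/- arXiv:math/0604300 — 4 statements merged into one kernel-verified Lean document; each statement's English description precedes it below -/
import Mathlib

section
/- Let F, V, s, Γ be as in the context. Then the pre-geometry Γ is transversal: every flag of Γ (every set of pairwise incident objects) is contained in a chamber, i.e. in a set of pairwise incident objects containing exactly one object of each dimension 1, …, dim V − 1. -/
variable {F V : Type} [Field F] [AddCommGroup V] [Module F V]

/-- The radical `Rad(U) = {x ∈ U : s(x,y) = 0 for all y ∈ U}` of a subspace `U`
with respect to the bilinear form `s`. -/
def rad (s : V →ₗ[F] V →ₗ[F] F) (U : Submodule F V) : Submodule F V where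
  carrier := {x | x ∈ U ∧ ∀ y ∈ U, s x y = 0}
  zero_mem' := ⟨U.zero_mem, fun y _ => by simp⟩
  add_mem' := by
    rintro a b ⟨haU, ha⟩ ⟨hbU, hb⟩
    exact ⟨U.add_mem haU hbU, fun y hy => by
      rw [map_add, LinearMap.add_apply, ha y hy, hb y hy, add_zero]⟩
  smul_mem' := by
    rintro c x ⟨hxU, hx⟩
    exact ⟨U.smul_mem c hxU, fun y hy => by
      rw [map_smul, LinearMap.smul_apply, hx y hy, smul_zero]⟩

/-- The orthogonal complement `U^⊥ = {v ∈ V : s(u,v) = 0 for all u ∈ U}`. -/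
def perp (s : V →ₗ[F] V →ₗ[F] F) (U : Submodule F V) : Submodule F V where
  carrier := {v | ∀ u ∈ U, s u v = 0}
  zero_mem' := fun u _ => by simp
  add_mem' := fun ha hb u hu => by rw [map_add, ha u hu, hb u hu, add_zero]
  smul_mem' := fun c x hx u hu => by rw [map_smul, hx u hu, smul_zero]

/-- `(e₁, …, e_{r+d}; f₁, …, f_r)` is a hyperbolic basis of the subspace `U` with respect to
the alternating form `s`: all vectors lie in `U`, `s(eᵢ,eⱼ) = 0 = s(fᵢ,fⱼ)`, `s(eᵢ,fⱼ) = δᵢⱼ`,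
the combined family is a basis of `U`, and `(e_{r+1}, …, e_{r+d})` is a basis of `Rad(U)`. -/
def IsHypBasis (s : V →ₗ[F] V →ₗ[F] F) (U : Submodule F V) (r d : ℕ)
    (e : Fin (r + d) → V) (f : Fin r → V) : Prop :=
  (∀ i, e i ∈ U) ∧ (∀ j, f j ∈ U) ∧
  (∀ i j, s (e i) (e j) = 0) ∧
  (∀ i j, s (f i) (f j) = 0) ∧
  (∀ (i : Fin (r + d)) (j : Fin r), s (e i) (f j) = if (i : ℕ) = (j : ℕ) then 1 else 0) ∧
  LinearIndependent F (Sum.elim e f) ∧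
  Submodule.span F (Set.range (Sum.elim e f)) = U ∧
  Submodule.span F (Set.range fun k : Fin d => e (Fin.natAdd r k)) = rad s U

/-- An object of the geometry `Γ`: a subspace `U` with `0 < dim U < dim V`,
`U ∩ Rad(V) = 0` and `dim Rad(U) ≤ 1`. -/
def IsObj (s : V →ₗ[F] V →ₗ[F] F) (U : Submodule F V) : Prop :=
  0 < Module.finrank F ↥U ∧ Module.finrank F ↥U < Module.finrank F V ∧
  U ⊓ rad s (⊤ : Submodule F V) = ⊥ ∧ Module.finrank F ↥(rad s U) ≤ 1

/-- Incidence in `Γ`: the smaller subspace is contained in the larger one and meets its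
radical trivially. -/
def Incid (s : V →ₗ[F] V →ₗ[F] F) (X Y : Submodule F V) : Prop :=
  (X ≤ Y ∧ X ⊓ rad s Y = ⊥) ∨ (Y ≤ X ∧ Y ⊓ rad s X = ⊥)

/-- A chamber of `Γ`: a set of pairwise incident objects containing exactly one object of
each dimension `1, …, dim V − 1`. -/
def IsChamber (s : V →ₗ[F] V →ₗ[F] F) (C : Set (Submodule F V)) : Prop :=
  (∀ X ∈ C, IsObj s X) ∧
  (∀ X ∈ C, ∀ Y ∈ C, X ≠ Y → Incid s X Y) ∧
  (∀ k : ℕ, 1 ≤ k → k ≤ Module.finrank F V - 1 →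
    ∃! X : Submodule F V, X ∈ C ∧ Module.finrank F ↥X = k)

theorem rad_le (s : V →ₗ[F] V →ₗ[F] F) (U : Submodule F V) : rad s U ≤ U :=
  fun _ hx => hx.1

theorem inf_rad_le (s : V →ₗ[F] V →ₗ[F] F) {X Y : Submodule F V} (h : X ≤ Y) :
    X ⊓ rad s Y ≤ rad s X :=
  fun _ hx => ⟨hx.1, fun y hy => hx.2.2 y (h hy)⟩

theorem inf_eq_bot_of_le {X Y R : Submodule F V} (h : X ≤ Y) (hY : Y ⊓ R = ⊥) : X ⊓ R = ⊥ :=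
  le_bot_iff.mp (hY ▸ inf_le_inf_right R h)

/-- A nondegenerate subspace `X` of `Y` extends by one dimension inside `Y`, avoiding `Rad(Y)`. -/
theorem exists_extension_of_rad_eq_bot [FiniteDimensional F V] (s : V →ₗ[F] V →ₗ[F] F)
    {X Y : Submodule F V} (hXY : X ≤ Y) (hXr : X ⊓ rad s Y = ⊥)
    (hY : Module.finrank F ↥(rad s Y) ≤ 1)
    (hdim : Module.finrank F ↥X + 2 ≤ Module.finrank F ↥Y) (hX : rad s X = ⊥) :
    ∃ Z : Submodule F V, X ≤ Z ∧ Z ≤ Y ∧ Module.finrank F ↥Z = Module.finrank F ↥X + 1 ∧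
      X ⊓ rad s Z = ⊥ ∧ Z ⊓ rad s Y = ⊥ ∧ Module.finrank F ↥(rad s Z) ≤ 1 := by
  have hlt : X ⊔ rad s Y < Y := by
    refine lt_of_le_of_ne (sup_le hXY (rad_le s Y)) fun h => ?_
    have := Submodule.finrank_add_le_finrank_add_finrank X (rad s Y)
    rw [h] at this
    omega
  obtain ⟨v, hvY, hv⟩ := SetLike.exists_of_lt hlt
  have hvX : v ∉ X := fun h => hv (Submodule.mem_sup_left h)
  have hXZ : X ≤ X ⊔ F ∙ v := le_sup_left
  have hZdim := Submodule.finrank_sup_span_singleton hvX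
  have hXZr : X ⊓ rad s (X ⊔ F ∙ v) = ⊥ := le_bot_iff.mp (hX ▸ inf_rad_le s hXZ)
  refine ⟨X ⊔ F ∙ v, hXZ, sup_le hXY (by simpa using hvY), hZdim, hXZr, ?_, ?_⟩
  · rw [Submodule.eq_bot_iff]
    rintro z ⟨hzZ, hzY⟩
    obtain ⟨x, hx, w, hw, rfl⟩ := Submodule.mem_sup.mp hzZ
    obtain ⟨c, rfl⟩ := Submodule.mem_span_singleton.mp hw
    have hc : c = 0 := by
      by_contra hc
      refine hv ?_
      rw [← Submodule.smul_mem_iff _ hc]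
      have := Submodule.sub_mem _ (Submodule.mem_sup_right hzY)
        (Submodule.mem_sup_left (T := rad s Y) hx)
      simpa using this
    subst hc
    rw [zero_smul, add_zero] at hzY ⊢
    exact (Submodule.eq_bot_iff _).mp hXr x ⟨hx, hzY⟩
  · have h1 := Submodule.finrank_sup_add_finrank_inf_eq X (rad s (X ⊔ F ∙ v))
    have h2 := Submodule.finrank_mono (sup_le hXZ (rad_le s (X ⊔ F ∙ v)))
    rw [hXZr, finrank_bot] at h1
    omega

/-- A subspace `X` of `Y` with one-dimensional radical not contained in `Rad(Y)` extends by one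
dimension to a nondegenerate subspace of `Y`. -/
theorem exists_extension_of_rad_ne_bot [FiniteDimensional F V] (s : V →ₗ[F] V →ₗ[F] F)
    (hs : ∀ v, s v v = 0) {X Y : Submodule F V} (hXY : X ≤ Y) (hXr : X ⊓ rad s Y = ⊥)
    (hX1 : Module.finrank F ↥(rad s X) ≤ 1) (hX : rad s X ≠ ⊥) :
    ∃ Z : Submodule F V, X ≤ Z ∧ Z ≤ Y ∧ Module.finrank F ↥Z = Module.finrank F ↥X + 1 ∧
      rad s Z = ⊥ := by
  have halt : s.IsAlt := hs
  obtain ⟨r, hr, hr0⟩ := Submodule.exists_mem_ne_zero_of_ne_bot hX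
  have hrY : r ∉ rad s Y := fun h => hr0 ((Submodule.eq_bot_iff _).mp hXr r ⟨hr.1, h⟩)
  obtain ⟨v, hvY, hrv⟩ : ∃ v ∈ Y, s r v ≠ 0 := by
    by_contra! h
    exact hrY ⟨hXY hr.1, h⟩
  have hvX : v ∉ X := fun h => hrv (hr.2 v h)
  have hXZ : X ≤ X ⊔ F ∙ v := le_sup_left
  have hvZ : v ∈ X ⊔ F ∙ v := Submodule.mem_sup_right (Submodule.mem_span_singleton_self v)
  have hfin : Module.finrank F ↥(rad s X) = 1 :=
    le_antisymm hX1 (Submodule.one_le_finrank_iff.mpr hX)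
  refine ⟨X ⊔ F ∙ v, hXZ, sup_le hXY (by simpa using hvY),
    Submodule.finrank_sup_span_singleton hvX, ?_⟩
  rw [Submodule.eq_bot_iff]
  intro z hz
  obtain ⟨x, hx, w, hw, rfl⟩ := Submodule.mem_sup.mp hz.1
  obtain ⟨c, rfl⟩ := Submodule.mem_span_singleton.mp hw
  have hxr : s x r = 0 := by rw [← halt.neg, hr.2 x hx, neg_zero]
  have hvr : s v r ≠ 0 := by rwa [← halt.neg, neg_ne_zero]
  have hc : c = 0 := by
    have := hz.2 r (hXZ hr.1)
    simpa [hxr, hvr] using this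
  subst hc
  rw [zero_smul, add_zero] at hz ⊢
  have hxX : x ∈ rad s X := ⟨hx, fun y hy => hz.2 y (hXZ hy)⟩
  obtain ⟨a, ha⟩ := exists_smul_eq_of_finrank_eq_one hfin
    (x := (⟨r, hr⟩ : rad s X)) (by simpa using hr0) ⟨x, hxX⟩
  have hax : a • r = x := congrArg Subtype.val ha
  have := hz.2 v hvZ
  rw [← hax] at this ⊢
  have ha0 : a = 0 := by simpa [hrv] using this
  rw [ha0, zero_smul]

theorem exists_extension [FiniteDimensional F V] (s : V →ₗ[F] V →ₗ[F] F)
    (hs : ∀ v, s v v = 0) {X Y : Submodule F V} (hXY : X ≤ Y) (hXr : X ⊓ rad s Y = ⊥)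
    (hX : Module.finrank F ↥(rad s X) ≤ 1) (hY : Module.finrank F ↥(rad s Y) ≤ 1)
    (hdim : Module.finrank F ↥X + 2 ≤ Module.finrank F ↥Y) :
    ∃ Z : Submodule F V, X ≤ Z ∧ Z ≤ Y ∧ Module.finrank F ↥Z = Module.finrank F ↥X + 1 ∧
      X ⊓ rad s Z = ⊥ ∧ Z ⊓ rad s Y = ⊥ ∧ Module.finrank F ↥(rad s Z) ≤ 1 := by
  by_cases h : rad s X = ⊥
  · exact exists_extension_of_rad_eq_bot s hXY hXr hY hdim h
  · obtain ⟨Z, hXZ, hZY, hZ, hrad⟩ := exists_extension_of_rad_ne_bot s hs hXY hXr hX h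
    refine ⟨Z, hXZ, hZY, hZ, ?_, ?_, ?_⟩
    · rw [hrad, inf_bot_eq]
    · exact le_bot_iff.mp (hrad ▸ inf_rad_le s hZY)
    · rw [hrad, finrank_bot]
      exact zero_le_one

theorem Incid.symm {s : V →ₗ[F] V →ₗ[F] F} {X Y : Submodule F V} (h : Incid s X Y) :
    Incid s Y X :=
  Or.symm h

theorem Incid.of_finrank_lt [FiniteDimensional F V] {s : V →ₗ[F] V →ₗ[F] F}
    {X Y : Submodule F V} (h : Incid s X Y) (hlt : Module.finrank F ↥X < Module.finrank F ↥Y) :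
    X ≤ Y ∧ X ⊓ rad s Y = ⊥ :=
  h.resolve_right fun h' => hlt.not_ge (Submodule.finrank_mono h'.1)

theorem Incid.eq_of_finrank_eq [FiniteDimensional F V] {s : V →ₗ[F] V →ₗ[F] F}
    {X Y : Submodule F V} (h : Incid s X Y) (heq : Module.finrank F ↥X = Module.finrank F ↥Y) :
    X = Y :=
  h.elim (fun h => Submodule.eq_of_le_of_finrank_eq h.1 heq)
    fun h => (Submodule.eq_of_le_of_finrank_eq h.1 heq.symm).symm

/-- A flag of `Γ`: a set of pairwise incident objects. -/
def IsFlag (s : V →ₗ[F] V →ₗ[F] F) (C : Set (Submodule F V)) : Prop :=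
  (∀ X ∈ C, IsObj s X) ∧ C.Pairwise (Incid s)

theorem IsFlag.exists_maximal {s : V →ₗ[F] V →ₗ[F] F} {C : Set (Submodule F V)}
    (hC : IsFlag s C) : ∃ D, C ⊆ D ∧ Maximal (IsFlag s) D := by
  refine zorn_subset_nonempty {D | IsFlag s D} (fun c hc hchain _ => ?_) C hC
  refine ⟨⋃₀ c, ⟨?_, ?_⟩, fun D hD => Set.subset_sUnion_of_mem hD⟩
  · rintro X ⟨D, hD, hX⟩
    exact (hc hD).1 X hX
  · exact (Set.pairwise_sUnion hchain.directedOn).mpr fun D hD => (hc hD).2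

/-- A maximal flag contains an object of every dimension. -/
theorem exists_finrank_eq_of_maximal [FiniteDimensional F V] {s : V →ₗ[F] V →ₗ[F] F}
    (hs : ∀ v, s v v = 0) (hrad : Module.finrank F ↥(rad s (⊤ : Submodule F V)) ≤ 1)
    {C : Set (Submodule F V)} (hC : Maximal (IsFlag s) C) {k : ℕ} (hk : 1 ≤ k)
    (hkn : k < Module.finrank F V) : ∃ X ∈ C, Module.finrank F ↥X = k := by
  by_contra! hno
  obtain ⟨hobj, hinc⟩ := hC.prop
  obtain ⟨X, ⟨hXC, hXk⟩, hXmax⟩ := wellFounded_gt.has_min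
    {X : Submodule F V | X ∈ insert ⊥ C ∧ Module.finrank F ↥X < k}
    ⟨⊥, Set.mem_insert _ _, by rw [finrank_bot]; exact hk⟩
  obtain ⟨Y, ⟨hYC, hYk⟩, hYmin⟩ := wellFounded_lt.has_min
    {Y : Submodule F V | Y ∈ insert ⊤ C ∧ k < Module.finrank F ↥Y}
    ⟨⊤, Set.mem_insert _ _, by rwa [finrank_top]⟩
  have hXY : X ≤ Y ∧ X ⊓ rad s Y = ⊥ := by
    rcases hXC with rfl | hXC
    · exact ⟨bot_le, bot_inf_eq _⟩
    rcases hYC with rfl | hYC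
    · exact ⟨le_top, (hobj X hXC).2.2.1⟩
    refine (hinc hXC hYC ?_).of_finrank_lt (hXk.trans hYk)
    rintro rfl
    omega
  have hXrad : Module.finrank F ↥(rad s X) ≤ 1 := by
    rcases hXC with rfl | hXC
    · exact (Submodule.finrank_mono (rad_le s ⊥)).trans (by simp)
    · exact (hobj X hXC).2.2.2
  have hYrad : Module.finrank F ↥(rad s Y) ≤ 1 := by
    rcases hYC with rfl | hYC
    · exact hrad
    · exact (hobj Y hYC).2.2.2
  have hYtop : Y ⊓ rad s ⊤ = ⊥ ∨ Y = ⊤ := by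
    rcases hYC with rfl | hYC
    · exact Or.inr rfl
    · exact Or.inl (hobj Y hYC).2.2.1
  obtain ⟨Z, hXZ, hZY, hZdim, hXZr, hZYr, hZrad⟩ :=
    exists_extension s hs hXY.1 hXY.2 hXrad hYrad (by omega)
  have hYn := Submodule.finrank_le Y
  have hZobj : IsObj s Z := by
    refine ⟨by omega, by omega, ?_, hZrad⟩
    rcases hYtop with h | rfl
    · exact inf_eq_bot_of_le hZY h
    · exact hZYr
  have hZinc : ∀ W ∈ C, Incid s Z W := by
    intro W hW
    rcases lt_or_gt_of_ne (hno W hW) with hWk | hWk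
    · have hWX : W ≤ X := by
        rcases hXC with rfl | hXC
        · by_contra hne
          exact hXmax W ⟨Or.inr hW, hWk⟩ (bot_lt_iff_ne_bot.mpr fun h => hne h.le)
        by_cases hne : W = X
        · exact hne.le
        rcases hinc hW hXC hne with h | h
        · exact h.1
        · exact (hXmax W ⟨Or.inr hW, hWk⟩ (lt_of_le_of_ne h.1 (Ne.symm hne))).elim
      exact Or.inr ⟨hWX.trans hXZ, inf_eq_bot_of_le hWX hXZr⟩
    · by_cases hne : W = Y
      · exact Or.inl (hne ▸ ⟨hZY, hZYr⟩)
      rcases hYC with rfl | hYC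
      · exact (hYmin W ⟨Or.inr hW, hWk⟩ (lt_top_iff_ne_top.mpr hne)).elim
      rcases hinc hYC hW (Ne.symm hne) with h | h
      · exact Or.inl ⟨hZY.trans h.1, inf_eq_bot_of_le hZY h.2⟩
      · exact (hYmin W ⟨Or.inr hW, hWk⟩ (lt_of_le_of_ne h.1 hne)).elim
  have hflag : IsFlag s (insert Z C) := by
    refine ⟨Set.forall_mem_insert.mpr ⟨hZobj, hobj⟩, Set.pairwise_insert.mpr ⟨hinc, ?_⟩⟩
    exact fun W hW _ => ⟨hZinc W hW, (hZinc W hW).symm⟩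
  have hZC : Z ∈ C := hC.le_of_ge hflag (Set.subset_insert Z C) (Set.mem_insert Z C)
  have := hno Z hZC
  refine hXmax Z ⟨Or.inr hZC, by omega⟩ (lt_of_le_of_ne hXZ ?_)
  rintro rfl
  omega

/-- **The pre-geometry `Γ` is transversal: every flag (set of pairwise incident objects)
is contained in a chamber.** -/
theorem gamma_transversal (F V : Type) [Field F] [AddCommGroup V] [Module F V]
    [FiniteDimensional F V] (s : V →ₗ[F] V →ₗ[F] F) (hs : ∀ v, s v v = 0)
    (hrad : Module.finrank F ↥(rad s (⊤ : Submodule F V)) ≤ 1) :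
    ∀ Fl : Set (Submodule F V),
      (∀ X ∈ Fl, IsObj s X) →
      (∀ X ∈ Fl, ∀ Y ∈ Fl, X ≠ Y → Incid s X Y) →
      ∃ C : Set (Submodule F V), IsChamber s C ∧ Fl ⊆ C := by
  intro Fl hobj hinc
  obtain ⟨C, hFC, hC⟩ := IsFlag.exists_maximal (s := s) (C := Fl)
    ⟨hobj, fun X hX Y hY h => hinc X hX Y hY h⟩
  refine ⟨C, ⟨hC.prop.1, fun X hX Y hY h => hC.prop.2 hX hY h, fun k hk hkn => ?_⟩, hFC⟩
  obtain ⟨X, hX, hXk⟩ := exists_finrank_eq_of_maximal hs hrad hC hk (by omega)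
  refine ⟨X, ⟨hX, hXk⟩, fun Y hY => ?_⟩
  by_contra hne
  exact hne ((hC.prop.2 hY.1 hX hne).eq_of_finrank_eq (hY.2.trans hXk.symm))
end

section
/- Let F be a field and V a finite-dimensional F-vector space with dim V ≥ 2, equipped with an alternating bilinear form s whose radical Rad(V) = {v ∈ V : s(v,w) = 0 for all w ∈ V} has dimension at most 1. Then: (i) for all nonzero vectors x, z ∈ V with x ∉ Rad(V) and z ∉ Rad(V), there exists y ∈ V with s(x,y) ≠ 0 and s(y,z) ≠ 0 (so the graph whose vertices are the 1-dimensional subspaces not contained in Rad(V), with ⟨x⟩ adjacent to ⟨z⟩ iff s(x,z) ≠ 0, has diameter at most 2); and (ii) if dim V ≥ 3 then there exist nonzero x, z ∉ Rad(V) spanning distinct 1-dimensional subspaces with s(x,z) = 0, so the diameter is exactly 2. -/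
variable {F V : Type} [Field F] [AddCommGroup V] [Module F V]

theorem exists_apply_ne_zero_of_notMem_rad_top {F V : Type} [Field F] [AddCommGroup V]
    [Module F V] {s : V →ₗ[F] V →ₗ[F] F} {x : V} (hx : x ∉ rad s (⊤ : Submodule F V)) :
    ∃ y, s x y ≠ 0 := by
  by_contra! h
  exact hx ⟨Submodule.mem_top, fun y _ => h y⟩

/-- Two vectors outside the radical have a common non-orthogonal vector. -/
theorem exists_common_apply_ne_zero {F V : Type} [Field F] [AddCommGroup V] [Module F V]
    {s : V →ₗ[F] V →ₗ[F] F} (hs : s.IsAlt) {x z : V}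
    (hx : x ∉ rad s (⊤ : Submodule F V)) (hz : z ∉ rad s (⊤ : Submodule F V)) :
    ∃ y, s x y ≠ 0 ∧ s y z ≠ 0 := by
  obtain ⟨a, ha⟩ := exists_apply_ne_zero_of_notMem_rad_top hx
  obtain ⟨b, hb⟩ := exists_apply_ne_zero_of_notMem_rad_top hz
  replace hb : s b z ≠ 0 := by
    rw [← hs.neg]
    exact neg_ne_zero.mpr hb
  by_cases haz : s a z = 0
  · by_cases hxb : s x b = 0
    · exact ⟨a + b, by simpa [hxb] using ha, by simpa [haz] using hb⟩
    · exact ⟨b, hxb, hb⟩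
  · exact ⟨a, ha, haz⟩

/-- In dimension at least three, the kernel of a linear functional lies in no line. -/
theorem exists_mem_ker_notMem_span_singleton {F V : Type} [Field F] [AddCommGroup V]
    [Module F V] [FiniteDimensional F V] (hdim : 3 ≤ Module.finrank F V) (f : V →ₗ[F] F)
    (x : V) : ∃ z, f z = 0 ∧ z ∉ Submodule.span F {x} := by
  have hnot : ¬ LinearMap.ker f ≤ Submodule.span F {x} := by
    intro hle
    have hker := Submodule.finrank_mono hle
    have hspan := (finrank_span_le_card (R := F) ({x} : Set V)).trans_eq (Set.toFinset_card _)
    have hrange := Submodule.finrank_le (LinearMap.range f)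
    have hsum := f.finrank_range_add_finrank_ker
    rw [Set.card_singleton] at hspan
    rw [Module.finrank_self] at hrange
    omega
  obtain ⟨z, hz, hzx⟩ := SetLike.not_le_iff_exists.mp hnot
  exact ⟨z, hz, hzx⟩

/-- **Connectedness of the point-line collinearity graph of `Γ`.**  (i) For any nonzero
`x, z ∉ Rad(V)` there is `y` with `s(x,y) ≠ 0 ≠ s(y,z)` (diameter at most 2 of the graph on
1-spaces not in the radical, adjacency `s ≠ 0`); (ii) if `dim V ≥ 3` there are nonzero
`x, z ∉ Rad(V)` spanning distinct lines with `s(x,z) = 0` (so the diameter is exactly 2). -/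
theorem collinearity_diameter_two (F V : Type) [Field F] [AddCommGroup V] [Module F V]
    [FiniteDimensional F V] (s : V →ₗ[F] V →ₗ[F] F) (hs : ∀ v, s v v = 0)
    (hdim : 2 ≤ Module.finrank F V)
    (hrad : Module.finrank F ↥(rad s (⊤ : Submodule F V)) ≤ 1) :
    ((∀ x z : V, x ≠ 0 → z ≠ 0 →
      x ∉ rad s (⊤ : Submodule F V) → z ∉ rad s (⊤ : Submodule F V) →
      ∃ y : V, s x y ≠ 0 ∧ s y z ≠ 0)) ∧
    (3 ≤ Module.finrank F V →
      ∃ x z : V, x ≠ 0 ∧ z ≠ 0 ∧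
        x ∉ rad s (⊤ : Submodule F V) ∧ z ∉ rad s (⊤ : Submodule F V) ∧
        Submodule.span F {x} ≠ Submodule.span F {z} ∧ s x z = 0) := by
  refine ⟨fun x z _ _ hx hz => exists_common_apply_ne_zero hs hx hz, fun hdim' => ?_⟩
  obtain ⟨x, hx⟩ : ∃ x, x ∉ rad s (⊤ : Submodule F V) := by
    by_contra! h
    rw [Submodule.eq_top_iff'.mpr h, finrank_top] at hrad
    omega
  suffices ∃ z, z ∉ rad s (⊤ : Submodule F V) ∧ s x z = 0 ∧ z ∉ Submodule.span F {x} by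
    obtain ⟨z, hz, hxz, hspan⟩ := this
    refine ⟨x, z, fun h => hx (h ▸ zero_mem _), fun h => hz (h ▸ zero_mem _), hx, hz,
      fun h => hspan ?_, hxz⟩
    rw [h]
    exact Submodule.mem_span_singleton_self z
  obtain ⟨z, hxz, hspan⟩ := exists_mem_ker_notMem_span_singleton hdim' (s x) x
  by_cases hz : z ∈ rad s (⊤ : Submodule F V)
  · refine ⟨x + z, fun h => hx ((Submodule.add_mem_iff_left _ hz).mp h), ?_, fun h => hspan ?_⟩
    · rw [map_add, hs, hxz, add_zero]
    · exact (Submodule.add_mem_iff_right _ (Submodule.mem_span_singleton_self x)).mp h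
  · exact ⟨z, hz, hxz, hspan⟩
end

section
/- Let F, V, s, p, H be as in the context and let W ≤ H be a hyperplane of H, i.e. dim W = dim H − 1 = dim V − 2. Say W is an object of Π(p,H) if Rad(V) is not contained in W, dim Rad(W) ≤ 2, and either Rad(W) = 0 or Rad(W) is not contained in p^⊥. Then: if dim V is even, W is always an object of Π(p,H); if dim V is odd, W is an object of Π(p,H) if and only if Rad(V) is not contained in W. -/
variable {F V : Type} [Field F] [AddCommGroup V] [Module F V]

theorem mem_rad {s : V →ₗ[F] V →ₗ[F] F} {U : Submodule F V} {x : V} :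
    x ∈ rad s U ↔ x ∈ U ∧ ∀ y ∈ U, s x y = 0 := Iff.rfl

theorem mem_perp {s : V →ₗ[F] V →ₗ[F] F} {U : Submodule F V} {x : V} :
    x ∈ perp s U ↔ ∀ u ∈ U, s u x = 0 := Iff.rfl

/-- The restriction of an alternating form to a subspace has even rank. -/
theorem even_finrank_add_finrank_rad [FiniteDimensional F V] (s : V →ₗ[F] V →ₗ[F] F)
    (hs : ∀ v, s v v = 0) (U : Submodule F V) :
    Even (Module.finrank F U + Module.finrank F (rad s U)) := by
  have hanti : ∀ a b, s a b = - s b a := fun a b => by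
    have h := hs (a + b)
    simp only [map_add, LinearMap.add_apply, hs, zero_add, add_zero] at h
    exact eq_neg_of_add_eq_zero_right h
  induction hn : Module.finrank F U using Nat.strong_induction_on generalizing U with
  | _ n ih =>
  by_cases hU : ∀ x ∈ U, ∀ y ∈ U, s x y = 0
  · have : rad s U = U := le_antisymm (fun x hx => hx.1) fun x hx => ⟨hx, hU x hx⟩
    rw [this, hn]
    exact ⟨n, rfl⟩
  push Not at hU
  obtain ⟨x, hx, y, hy, hxy⟩ := hU
  have hyx : s y x ≠ 0 := by rw [hanti]; exact neg_ne_zero.mpr hxy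
  let L : V →ₗ[F] F × F := (s x).prod (s y)
  let U' : Submodule F V := U ⊓ LinearMap.ker L
  have hU' : ∀ v, v ∈ U' ↔ v ∈ U ∧ s x v = 0 ∧ s y v = 0 := fun v => by
    simp [U', L, LinearMap.mem_ker]
  have hrange : LinearMap.range (L.domRestrict U) = ⊤ := by
    rw [LinearMap.range_eq_top]
    rintro ⟨a, b⟩
    refine ⟨⟨(b / s y x) • x + (a / s x y) • y,
      U.add_mem (U.smul_mem _ hx) (U.smul_mem _ hy)⟩, ?_⟩
    simp [L, hs, hxy, hyx]
  have hker : Module.finrank F (LinearMap.ker (L.domRestrict U)) = Module.finrank F U' := by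
    rw [← Submodule.finrank_map_subtype_eq U (LinearMap.ker (L.domRestrict U))]
    have hmap : Submodule.map U.subtype (LinearMap.ker (L.domRestrict U)) = U' := by
      ext v
      simp [U', and_comm]
    rw [hmap]
  have hdim := LinearMap.finrank_range_add_finrank_ker (L.domRestrict U)
  rw [hrange, finrank_top, hker, hn, Module.finrank_prod, Module.finrank_self] at hdim
  have hradU : rad s U' = rad s U := by
    ext u
    rw [mem_rad, mem_rad, hU']
    constructor
    · rintro ⟨⟨hu, hxu, hyu⟩, h⟩
      refine ⟨hu, fun v hv => ?_⟩
      have hv' := h (v - (s y v / s y x) • x - (s x v / s x y) • y) ((hU' _).2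
        ⟨U.sub_mem (U.sub_mem hv (U.smul_mem _ hx)) (U.smul_mem _ hy), by
          simp [hs, hxy], by simp [hs, hyx]⟩)
      simpa [hanti u x, hanti u y, hxu, hyu] using hv'
    · rintro ⟨hu, h⟩
      exact ⟨⟨hu, by rw [hanti, h x hx, neg_zero], by rw [hanti, h y hy, neg_zero]⟩,
        fun v hv => h v ((hU' v).1 hv).1⟩
  have hev := ih _ (by omega) U' rfl
  rw [hradU] at hev
  rw [← hdim, add_assoc]
  exact Even.add (by decide) hev

/-- If `A` meets the radical trivially and is orthogonal to `B`, then `dim A + dim B ≤ dim V`. -/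
theorem finrank_add_finrank_le_of_orthogonal [FiniteDimensional F V]
    (s : V →ₗ[F] V →ₗ[F] F) {A B : Submodule F V} (hA : rad s ⊤ ⊓ A = ⊥)
    (hAB : ∀ a ∈ A, ∀ b ∈ B, s a b = 0) :
    Module.finrank F A + Module.finrank F B ≤ Module.finrank F V := by
  have hinj : Function.Injective (s.domRestrict A) := by
    rw [← LinearMap.ker_eq_bot, LinearMap.ker_eq_bot']
    rintro ⟨a, ha⟩ h
    have : a ∈ rad s ⊤ ⊓ A :=
      ⟨⟨Submodule.mem_top, fun y _ => LinearMap.congr_fun h y⟩, ha⟩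
    rw [hA, Submodule.mem_bot] at this
    simpa using this
  have hle : LinearMap.range (s.domRestrict A) ≤ B.dualAnnihilator := by
    rintro _ ⟨⟨a, ha⟩, rfl⟩
    exact (Submodule.mem_dualAnnihilator _).2 fun b hb => hAB a ha b hb
  have h1 := Submodule.finrank_mono hle
  rw [LinearMap.finrank_range_of_inj hinj] at h1
  exact (Nat.add_le_add_right h1 _).trans_eq
    ((add_comm _ _).trans (Subspace.finrank_add_finrank_dualAnnihilator_eq B))

/-- **Hyperplanes of `H` as objects of `Π(p,H)`.**  Let `W ≤ H` with
`dim W = dim H − 1 (= dim V − 2)`.  If `dim V` is even then `W` is always an object of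
`Π(p,H)`; if `dim V` is odd then `W` is an object of `Π(p,H)` iff `Rad(V)` is not contained
in `W` (i.e. `Rad(V) ∩ W = 0`). -/
theorem hyperplanes_of_Pi (F V : Type) [Field F] [AddCommGroup V] [Module F V]
    [FiniteDimensional F V] (s : V →ₗ[F] V →ₗ[F] F) (hs : ∀ v, s v v = 0)
    (hdim : 4 ≤ Module.finrank F V)
    (hrad : Module.finrank F ↥(rad s (⊤ : Submodule F V)) ≤ 1)
    (p H : Submodule F V) (hp : Module.finrank F ↥p = 1)
    (hpr : p ⊓ rad s (⊤ : Submodule F V) = ⊥)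
    (hcompl : IsCompl p H) (hrH : rad s (⊤ : Submodule F V) ≤ H)
    (W : Submodule F V) (hWH : W ≤ H)
    (hWdim : Module.finrank F ↥W + 1 = Module.finrank F ↥H) :
    (Even (Module.finrank F V) →
      (rad s (⊤ : Submodule F V) ⊓ W = ⊥ ∧ Module.finrank F ↥(rad s W) ≤ 2 ∧
        (rad s W = ⊥ ∨ ¬ (rad s W ≤ perp s p)))) ∧
    (Odd (Module.finrank F V) →
      ((rad s (⊤ : Submodule F V) ⊓ W = ⊥ ∧ Module.finrank F ↥(rad s W) ≤ 2 ∧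
        (rad s W = ⊥ ∨ ¬ (rad s W ≤ perp s p))) ↔
       rad s (⊤ : Submodule F V) ⊓ W = ⊥)) := by
  have hVpar := even_finrank_add_finrank_rad s hs ⊤
  have hWpar := even_finrank_add_finrank_rad s hs W
  rw [finrank_top] at hVpar
  have hpH := Submodule.finrank_add_eq_of_isCompl hcompl
  have key : rad s (⊤ : Submodule F V) ⊓ W = ⊥ → Module.finrank F ↥(rad s W) ≤ 2 ∧
      (rad s W = ⊥ ∨ ¬ (rad s W ≤ perp s p)) := by
    intro hTW
    have hRT : rad s ⊤ ⊓ rad s W = ⊥ :=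
      eq_bot_iff.2 (hTW ▸ inf_le_inf_left _ fun x hx => hx.1)
    have hRW := finrank_add_finrank_le_of_orthogonal s hRT fun a ha b hb => ha.2 b hb
    refine ⟨by omega, or_iff_not_imp_right.2 fun hperp => ?_⟩
    rw [not_not] at hperp
    have hRp : ∀ a ∈ rad s W, ∀ b ∈ p, s a b = 0 := fun a ha b hb => by
      have h := hs (a + b)
      simp only [map_add, LinearMap.add_apply, hs, zero_add, add_zero,
        mem_perp.1 (hperp ha) b hb] at h
      exact h
    have hdisj : (W ⊔ rad s ⊤) ⊓ p = ⊥ :=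
      eq_bot_iff.2 ((inf_le_inf_right p (sup_le hWH hrH)).trans
        hcompl.symm.inf_eq_bot.le)
    have hsum := Submodule.finrank_sup_add_finrank_inf_eq (W ⊔ rad s ⊤) p
    have hsum' := Submodule.finrank_sup_add_finrank_inf_eq W (rad s ⊤)
    rw [hdisj, finrank_bot] at hsum
    rw [inf_comm, hTW, finrank_bot] at hsum'
    have hT : ∀ a : V, ∀ b ∈ rad s ⊤, s a b = 0 := fun a b hb => by
      have h := hs (a + b)
      simp only [map_add, LinearMap.add_apply, hs, zero_add, add_zero,
        hb.2 a Submodule.mem_top] at h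
      exact h
    have hle := finrank_add_finrank_le_of_orthogonal (B := W ⊔ rad s ⊤ ⊔ p) s hRT
      fun a ha => show W ⊔ rad s ⊤ ⊔ p ≤ LinearMap.ker (s a) from
        sup_le (sup_le (fun b hb => ha.2 b hb) fun b hb => hT a b hb) fun b hb => hRp a ha b hb
    rw [← Submodule.finrank_eq_zero (R := F)]
    rw [Nat.even_iff] at hVpar hWpar
    omega
  refine ⟨fun hev => ?_, fun _ => ⟨And.left, fun h => ⟨h, key h⟩⟩⟩
  have hT0 : rad s (⊤ : Submodule F V) = ⊥ := by
    rw [← Submodule.finrank_eq_zero (R := F)]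
    rw [Nat.even_iff] at hVpar hev
    omega
  have hTW : rad s (⊤ : Submodule F V) ⊓ W = ⊥ := by rw [hT0, bot_inf_eq]
  exact ⟨hTW, key hTW⟩
end

section
/- Let F, V, s, Γ be as in the context and let Sp(V) be the group of linear automorphisms of V preserving s. Then Sp(V) acts flag-transitively on Γ: for any two flags F_1, F_2 of Γ (sets of pairwise incident objects) with the same type, i.e. {dim X : X ∈ F_1} = {dim X : X ∈ F_2}, there exists g ∈ Sp(V) with {g(X) : X ∈ F_1} = F_2. -/
variable {F V : Type} [Field F] [AddCommGroup V] [Module F V]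

open Module

universe u

section Witt

variable {K X Y Y' : Type u} [Field K] [AddCommGroup X] [Module K X]
  [AddCommGroup Y] [Module K Y] [AddCommGroup Y'] [Module K Y']

/-- A map whose range meets the radical trivially is injective together with the inclusion of
the radical. -/
lemma coprod_ker_injective {B : LinearMap.BilinForm K Y} {i : X →ₗ[K] Y}
    (hi : ∀ x, B (i x) = 0 → x = 0) :
    Function.Injective (i.coprod (LinearMap.ker B).subtype) := by
  rw [injective_iff_map_eq_zero]
  rintro ⟨x, r, hr⟩ h
  simp only [LinearMap.coprod_apply, Submodule.subtype_apply] at h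
  have hx : x = 0 := hi x (by
    rw [eq_neg_of_add_eq_zero_left h, map_neg, LinearMap.mem_ker.1 hr, neg_zero])
  subst hx
  simpa using h

lemma injective_of_ker {B : LinearMap.BilinForm K Y} {i : X →ₗ[K] Y}
    (hi : ∀ x, B (i x) = 0 → x = 0) : Function.Injective i :=
  (injective_iff_map_eq_zero i).2 fun x hx => hi x (by rw [hx, map_zero])

lemma range_coprod_ker (B : LinearMap.BilinForm K Y) (i : X →ₗ[K] Y) :
    LinearMap.range (i.coprod (LinearMap.ker B).subtype) =
      LinearMap.range i ⊔ LinearMap.ker B := by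
  rw [LinearMap.range_coprod, Submodule.range_subtype]

/-- Adjoining a vector outside `range i ⊔ ker B` keeps the range away from the radical. -/
lemma coprod_toSpanSingleton_eq_zero {B : LinearMap.BilinForm K Y} {i : X →ₗ[K] Y}
    (hi : ∀ x, B (i x) = 0 → x = 0) {v : Y} (hv : v ∉ LinearMap.range i ⊔ LinearMap.ker B)
    (p : X × K) (hp : B (i.coprod (LinearMap.toSpanSingleton K Y v) p) = 0) : p = 0 := by
  obtain ⟨x, t⟩ := p
  simp only [LinearMap.coprod_apply, LinearMap.toSpanSingleton_apply] at hp
  have ht : t = 0 := by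
    by_contra ht
    have hmem : t • v ∈ LinearMap.range i ⊔ LinearMap.ker B := by
      have : t • v = -(i x) + (i x + t • v) := by abel
      rw [this]
      exact Submodule.add_mem_sup (neg_mem (LinearMap.mem_range_self i x)) hp
    exact hv ((Submodule.smul_mem_iff _ ht).1 hmem)
  subst ht
  rw [zero_smul, add_zero] at hp
  rw [hi x hp, Prod.mk_zero_zero]

/-- Every functional on `X` is `x ↦ B (i x) v` for some `v`. -/
lemma exists_represents [FiniteDimensional K X] {B : LinearMap.BilinForm K Y} {i : X →ₗ[K] Y}
    (hi : ∀ x, B (i x) = 0 → x = 0) (φ : Dual K X) : ∃ v, ∀ x, B (i x) v = φ x := by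
  have hinj : Function.Injective (B ∘ₗ i) := (injective_iff_map_eq_zero _).2 hi
  obtain ⟨v, hv⟩ := (LinearMap.flip_surjective_iff₁ (B := B ∘ₗ i)).2 hinj φ
  exact ⟨v, fun x => LinearMap.congr_fun hv x⟩

variable [FiniteDimensional K X] [FiniteDimensional K Y] [FiniteDimensional K Y']

lemma sup_ker_eq_top_iff {B : LinearMap.BilinForm K Y} {i : X →ₗ[K] Y}
    (hi : ∀ x, B (i x) = 0 → x = 0) :
    LinearMap.range i ⊔ LinearMap.ker B = ⊤ ↔
      finrank K Y = finrank K X + finrank K (LinearMap.ker B) := by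
  rw [← range_coprod_ker, ← finrank_prod,
    ← LinearMap.finrank_range_of_inj (coprod_ker_injective hi)]
  refine ⟨fun h => by rw [h, finrank_top], fun h => Submodule.eq_top_of_finrank_eq h.symm⟩

/-- Whether `(range i)^⊥` lies in `range i ⊔ ker B` depends only on dimensions. -/
lemma orthogonal_le_sup_ker_iff {B : LinearMap.BilinForm K Y} (hB : B.IsAlt) {i : X →ₗ[K] Y}
    (hi : ∀ x, B (i x) = 0 → x = 0) :
    B.orthogonal (LinearMap.range i) ≤ LinearMap.range i ⊔ LinearMap.ker B ↔
      finrank K Y ≤ finrank K X + finrank K (LinearMap.ker (B.compl₁₂ i i)) +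
        finrank K (LinearMap.ker B) := by
  set N := LinearMap.ker (B.compl₁₂ i i) with hN
  set k : N × LinearMap.ker B →ₗ[K] Y := (i ∘ₗ N.subtype).coprod (LinearMap.ker B).subtype with hk
  have hkinj : Function.Injective k := by
    apply coprod_ker_injective
    intro x hx
    exact Subtype.ext (hi _ hx)
  have hkle : LinearMap.range k ≤ B.orthogonal (LinearMap.range i) := by
    rintro _ ⟨⟨⟨x, hx⟩, r, hr⟩, rfl⟩ _ ⟨z, rfl⟩
    apply hB.isRefl
    have h1 : B (i x) (i z) = 0 := LinearMap.congr_fun (LinearMap.mem_ker.1 hx) z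
    simp [hk, h1, LinearMap.mem_ker.1 hr]
  have hdim := LinearMap.BilinForm.finrank_add_finrank_orthogonal' (B := B) (LinearMap.range i)
  have hbot : LinearMap.range i ⊓ LinearMap.ker B = ⊥ := by
    rw [eq_bot_iff]
    rintro _ ⟨⟨x, rfl⟩, hx⟩
    rw [hi x hx, map_zero]
    exact zero_mem _
  rw [hbot, finrank_bot, LinearMap.finrank_range_of_inj (injective_of_ker hi)] at hdim
  have hkdim := LinearMap.finrank_range_of_inj hkinj
  rw [finrank_prod] at hkdim
  constructor
  · intro h
    have hle : B.orthogonal (LinearMap.range i) ≤ LinearMap.range k := by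
      intro y hy
      have hy' := h hy
      rw [← range_coprod_ker] at hy'
      obtain ⟨⟨x, r⟩, rfl⟩ := hy'
      refine ⟨(⟨x, LinearMap.mem_ker.2 (LinearMap.ext fun z => ?_)⟩, r), rfl⟩
      have h2 := hB.isRefl _ _ (hy (i z) ⟨z, rfl⟩)
      simpa [LinearMap.mem_ker.1 r.2] using h2
    have := Submodule.finrank_mono hle
    omega
  · intro h
    have heq : LinearMap.range k = B.orthogonal (LinearMap.range i) :=
      Submodule.eq_of_le_of_finrank_le hkle (by omega)
    rw [← heq, ← range_coprod_ker]
    rintro _ ⟨⟨x, r⟩, rfl⟩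
    exact ⟨(x, r), rfl⟩

/-- The one-vector step in Witt's extension theorem for alternating forms. -/
lemma exists_compatible_vectors {B : LinearMap.BilinForm K Y} {B' : LinearMap.BilinForm K Y'}
    (hB : B.IsAlt) (hB' : B'.IsAlt) (hdim : finrank K Y = finrank K Y')
    (hker : finrank K (LinearMap.ker B) = finrank K (LinearMap.ker B'))
    {i : X →ₗ[K] Y} {i' : X →ₗ[K] Y'}
    (hi : ∀ x, B (i x) = 0 → x = 0) (hi' : ∀ x, B' (i' x) = 0 → x = 0)
    (h : B.compl₁₂ i i = B'.compl₁₂ i' i')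
    (hne : LinearMap.range i ⊔ LinearMap.ker B ≠ ⊤) :
    ∃ v v', v ∉ LinearMap.range i ⊔ LinearMap.ker B ∧
      v' ∉ LinearMap.range i' ⊔ LinearMap.ker B' ∧ ∀ x, B (i x) v = B' (i' x) v' := by
  obtain ⟨v, hv⟩ : ∃ v, v ∉ LinearMap.range i ⊔ LinearMap.ker B := by
    by_contra! hall
    exact hne (eq_top_iff.2 fun v _ => hall v)
  obtain ⟨v', hv'⟩ := exists_represents hi' (B.flip v ∘ₗ i)
  by_cases hmem : v' ∈ LinearMap.range i' ⊔ LinearMap.ker B'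
  · have hmem' := hmem
    rw [← range_coprod_ker] at hmem'
    obtain ⟨⟨x, r⟩, hx⟩ := hmem'
    have hnle : ¬ B.orthogonal (LinearMap.range i) ≤ LinearMap.range i ⊔ LinearMap.ker B := by
      intro hle
      apply hv
      have hu : v - i x ∈ LinearMap.range i ⊔ LinearMap.ker B := by
        apply hle
        rintro _ ⟨z, rfl⟩
        have h1 : B (i z) v = B' (i' z) v' := (hv' z).symm
        have h2 : B (i z) (i x) = B' (i' z) (i' x) := LinearMap.congr_fun₂ h z x
        have h3 : B' (i' z) r = 0 := hB'.isRefl _ _ (by simp [LinearMap.mem_ker.1 r.2])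
        have h4 : i' x + r = v' := hx
        simp only [map_sub, h1, h2, ← h4, map_add, h3]
        ring
      have := Submodule.add_mem _ hu
        (Submodule.mem_sup_left (LinearMap.mem_range_self i x))
      rwa [sub_add_cancel] at this
    have hnle' : ¬ B'.orthogonal (LinearMap.range i') ≤
        LinearMap.range i' ⊔ LinearMap.ker B' := by
      rwa [orthogonal_le_sup_ker_iff hB' hi', ← h, ← hdim, ← hker,
        ← orthogonal_le_sup_ker_iff hB hi]
    obtain ⟨w, hw, hwn⟩ := SetLike.not_le_iff_exists.1 hnle'
    refine ⟨v, v' + w, hv, fun hs => hwn ?_, fun x => ?_⟩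
    · simpa using Submodule.sub_mem _ hs hmem
    · rw [map_add, hw (i' x) ⟨x, rfl⟩, add_zero, hv' x]
      rfl
  · exact ⟨v, v', hv, hmem, fun x => (hv' x).symm⟩

/-- The case of Witt's extension theorem in which the embedded space is a complement of the
radical. -/
lemma exists_isometry_of_sup_ker_eq_top {B : LinearMap.BilinForm K Y}
    {B' : LinearMap.BilinForm K Y'} (hB : B.IsAlt) (hB' : B'.IsAlt)
    (hdim : finrank K Y = finrank K Y')
    (hker : finrank K (LinearMap.ker B) = finrank K (LinearMap.ker B'))
    {i : X →ₗ[K] Y} {i' : X →ₗ[K] Y'}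
    (hi : ∀ x, B (i x) = 0 → x = 0) (hi' : ∀ x, B' (i' x) = 0 → x = 0)
    (h : B.compl₁₂ i i = B'.compl₁₂ i' i')
    (htop : LinearMap.range i ⊔ LinearMap.ker B = ⊤) :
    ∃ g : Y ≃ₗ[K] Y', (∀ v w, B' (g v) (g w) = B v w) ∧ ∀ x, g (i x) = i' x := by
  have htop' : LinearMap.range i' ⊔ LinearMap.ker B' = ⊤ := by
    rwa [sup_ker_eq_top_iff hi', ← hker, ← hdim, ← sup_ker_eq_top_iff hi]
  let e := LinearEquiv.ofBijective _ ⟨coprod_ker_injective hi,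
    LinearMap.range_eq_top.1 ((range_coprod_ker B i).trans htop)⟩
  let e' := LinearEquiv.ofBijective _ ⟨coprod_ker_injective hi',
    LinearMap.range_eq_top.1 ((range_coprod_ker B' i').trans htop')⟩
  let c := LinearEquiv.ofFinrankEq (LinearMap.ker B) (LinearMap.ker B') hker
  let m := (LinearEquiv.refl K X).prodCongr c
  have he : ∀ p, e p = i p.1 + p.2 := fun p => rfl
  have he' : ∀ p, e' p = i' p.1 + p.2 := fun p => rfl
  have hpair : ∀ p q, B (e p) (e q) = B (i p.1) (i q.1) := by
    intro p q
    have h1 : B (i p.1) q.2 = 0 := hB.isRefl _ _ (by simp [LinearMap.mem_ker.1 q.2.2])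
    simp [he, LinearMap.mem_ker.1 p.2.2, h1]
  have hpair' : ∀ p q, B' (e' p) (e' q) = B' (i' p.1) (i' q.1) := by
    intro p q
    have h1 : B' (i' p.1) q.2 = 0 := hB'.isRefl _ _ (by simp [LinearMap.mem_ker.1 q.2.2])
    simp [he', LinearMap.mem_ker.1 p.2.2, h1]
  have hg : ∀ p, (e.symm ≪≫ₗ m ≪≫ₗ e') (e p) = e' (m p) := by simp
  refine ⟨e.symm ≪≫ₗ m ≪≫ₗ e', fun v w => ?_, fun x => ?_⟩
  · obtain ⟨p, rfl⟩ := e.surjective v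
    obtain ⟨q, rfl⟩ := e.surjective w
    rw [hg, hg, hpair, hpair']
    exact (LinearMap.congr_fun₂ h p.1 q.1).symm
  · have hx : i x = e (x, 0) := by simp [he]
    rw [hx, hg]
    simp [he', m]

/-- Witt's extension theorem for alternating forms: two embeddings of a space into alternating
spaces of the same dimension and radical dimension which induce the same form and whose ranges
avoid the radicals differ by an isometry. -/
theorem exists_isometry_extending {B : LinearMap.BilinForm K Y} {B' : LinearMap.BilinForm K Y'}
    (hB : B.IsAlt) (hB' : B'.IsAlt) (hdim : finrank K Y = finrank K Y')
    (hker : finrank K (LinearMap.ker B) = finrank K (LinearMap.ker B'))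
    {i : X →ₗ[K] Y} {i' : X →ₗ[K] Y'}
    (hi : ∀ x, B (i x) = 0 → x = 0) (hi' : ∀ x, B' (i' x) = 0 → x = 0)
    (h : B.compl₁₂ i i = B'.compl₁₂ i' i') :
    ∃ g : Y ≃ₗ[K] Y', (∀ v w, B' (g v) (g w) = B v w) ∧ ∀ x, g (i x) = i' x := by
  obtain ⟨n, hn⟩ : ∃ n, finrank K Y ≤ finrank K X + n := ⟨_, Nat.le_add_left _ _⟩
  induction n generalizing X with
  | zero =>
    refine exists_isometry_of_sup_ker_eq_top hB hB' hdim hker hi hi' h ?_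
    rw [eq_top_iff]
    refine le_trans ?_ le_sup_left
    rw [Submodule.eq_top_of_finrank_eq (S := LinearMap.range i)]
    have := LinearMap.finrank_range_of_inj (injective_of_ker hi)
    have := Submodule.finrank_le (LinearMap.range i)
    omega
  | succ n ih =>
    by_cases htop : LinearMap.range i ⊔ LinearMap.ker B = ⊤
    · exact exists_isometry_of_sup_ker_eq_top hB hB' hdim hker hi hi' h htop
    obtain ⟨v, v', hv, hv', hvv⟩ :=
      exists_compatible_vectors hB hB' hdim hker hi hi' h htop
    have hvv' : ∀ x, B v (i x) = B' v' (i' x) := fun x => by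
      rw [← hB.neg_eq, ← hB'.neg_eq, hvv]
    have hii : ∀ x y, B (i x) (i y) = B' (i' x) (i' y) := LinearMap.congr_fun₂ h
    obtain ⟨g, hg, hgx⟩ := ih (X := X × K)
      (coprod_toSpanSingleton_eq_zero hi hv) (coprod_toSpanSingleton_eq_zero hi' hv')
      (LinearMap.ext₂ fun p q => by
        simp [LinearMap.compl₁₂_apply, hii, hvv, hvv', hB.self_eq_zero v, hB'.self_eq_zero v'])
      (by rw [finrank_prod, finrank_self]; omega)
    exact ⟨g, hg, fun x => by simpa using hgx (x, 0)⟩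

end Witt

/-- The dimension of an alternating space has the parity of the dimension of its radical. -/
lemma even_finrank_add_finrank_ker {K Y : Type*} [Field K] [AddCommGroup Y] [Module K Y]
    [FiniteDimensional K Y] {B : LinearMap.BilinForm K Y} (hB : B.IsAlt) :
    Even (finrank K Y + finrank K (LinearMap.ker B)) := by
  obtain ⟨L, hL⟩ : ∃ L : Submodule K Y, Maximal (fun L => L ≤ B.orthogonal L) L := by
    obtain ⟨L, -, hL⟩ := exists_maximal_ge_of_wellFoundedGT
      (fun L : Submodule K Y => L ≤ B.orthogonal L) ⊥ bot_le
    exact ⟨L, hL⟩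
  have horth : B.orthogonal L ≤ L := by
    intro v hv
    have hle : L ⊔ K ∙ v ≤ L := by
      refine hL.2 ?_ le_sup_left
      intro x hx y hy
      obtain ⟨a, ha, _, hw, rfl⟩ := Submodule.mem_sup.1 hx
      obtain ⟨s, rfl⟩ := Submodule.mem_span_singleton.1 hw
      obtain ⟨b, hb, _, hw, rfl⟩ := Submodule.mem_sup.1 hy
      obtain ⟨t, rfl⟩ := Submodule.mem_span_singleton.1 hw
      have h1 : B b a = 0 := hL.1 ha b hb
      have h2 : B b v = 0 := hv b hb
      have h3 : B v a = 0 := hB.isRefl _ _ (hv a ha)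
      simp [h1, h2, h3, hB.self_eq_zero v]
    exact hle (Submodule.mem_sup_right (Submodule.mem_span_singleton_self v))
  have heq : B.orthogonal L = L := le_antisymm horth hL.1
  have hker : LinearMap.ker B ≤ L := by
    intro x hx
    apply horth
    intro y _
    exact hB.isRefl _ _ (by simp [LinearMap.mem_ker.1 hx])
  have := LinearMap.BilinForm.finrank_add_finrank_orthogonal' (B := B) L
  rw [heq, inf_eq_right.2 hker] at this
  exact ⟨_, this.symm⟩

section Restriction

variable {K W : Type} [Field K] [AddCommGroup W] [Module K W]
  {s : W →ₗ[K] W →ₗ[K] K}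

lemma mem_ker_restrict_iff {U : Submodule K W} (x : U) :
    x ∈ LinearMap.ker (LinearMap.BilinForm.restrict s U) ↔ (x : W) ∈ rad s U := by
  rw [LinearMap.mem_ker, LinearMap.ext_iff]
  exact ⟨fun h => ⟨x.2, fun y hy => h ⟨y, hy⟩⟩, fun h y => h.2 y y.2⟩

lemma finrank_ker_restrict (U : Submodule K W) :
    finrank K (LinearMap.ker (LinearMap.BilinForm.restrict s U)) = finrank K (rad s U) := by
  have h : LinearMap.ker (LinearMap.BilinForm.restrict s U) = (rad s U).comap U.subtype := by
    ext x
    exact mem_ker_restrict_iff x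
  rw [h]
  exact (Submodule.comapSubtypeEquivOfLe (show rad s U ≤ U from fun _ hx => hx.1)).finrank_eq

lemma rad_bot : rad s ⊥ = ⊥ := eq_bot_iff.2 fun _ hx => hx.1

/-- A flag enlarged by `⊥` and `⊤` still consists of pairwise incident subspaces. -/
lemma incid_insert_bot_top {C : Set (Submodule K W)} (ho : ∀ X ∈ C, IsObj s X)
    (hi : ∀ X ∈ C, ∀ Y ∈ C, X ≠ Y → Incid s X Y) :
    ∀ X ∈ insert ⊥ (insert ⊤ C), ∀ Y ∈ insert ⊥ (insert ⊤ C), X ≠ Y → Incid s X Y := by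
  rintro X (rfl | rfl | hX) Y (rfl | rfl | hY) hne
  · exact absurd rfl hne
  · exact Or.inl ⟨bot_le, bot_inf_eq _⟩
  · exact Or.inl ⟨bot_le, bot_inf_eq _⟩
  · exact Or.inr ⟨bot_le, bot_inf_eq _⟩
  · exact absurd rfl hne
  · exact Or.inr ⟨le_top, (ho Y hY).2.2.1⟩
  · exact Or.inr ⟨bot_le, bot_inf_eq _⟩
  · exact Or.inl ⟨le_top, (ho X hX).2.2.1⟩
  · exact hi X hX Y hY hne

lemma finrank_rad_insert_bot_top {C : Set (Submodule K W)} (ho : ∀ X ∈ C, IsObj s X)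
    (hrad : finrank K (rad s (⊤ : Submodule K W)) ≤ 1) :
    ∀ X ∈ insert ⊥ (insert ⊤ C), finrank K (rad s X) ≤ 1 := by
  rintro X (rfl | rfl | hX)
  · rw [rad_bot, finrank_bot]
    exact zero_le_one
  · exact hrad
  · exact (ho X hX).2.2.2

variable [FiniteDimensional K W]

/-- In an alternating space, the dimension of a subspace determines the dimension of its radical
as soon as the latter is at most one. -/
lemma finrank_rad_eq (hs : ∀ v, s v v = 0) {Z Z' : Submodule K W}
    (hdim : finrank K Z = finrank K Z') (hZ : finrank K (rad s Z) ≤ 1)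
    (hZ' : finrank K (rad s Z') ≤ 1) : finrank K (rad s Z) = finrank K (rad s Z') := by
  have h := even_finrank_add_finrank_ker (B := LinearMap.BilinForm.restrict s Z) fun x => hs x
  have h' := even_finrank_add_finrank_ker (B := LinearMap.BilinForm.restrict s Z') fun x => hs x
  rw [finrank_ker_restrict] at h h'
  grind

/-- Isometries between subspaces extend along incidences. -/
lemma exists_isometry_extending_subspace (hs : ∀ v, s v v = 0) {X X' Z Z' : Submodule K W}
    (hXZ : X ≤ Z) (hXZ' : X' ≤ Z') (hX : X ⊓ rad s Z = ⊥) (hX' : X' ⊓ rad s Z' = ⊥)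
    (hdim : finrank K Z = finrank K Z') (hZ : finrank K (rad s Z) ≤ 1)
    (hZ' : finrank K (rad s Z') ≤ 1) (f : X ≃ₗ[K] X')
    (hf : ∀ x y : X, s (f x) (f y) = s x y) :
    ∃ g : Z ≃ₗ[K] Z', (∀ x y : Z, s (g x) (g y) = s x y) ∧
      ∀ (x : W) (hx : x ∈ X), (g ⟨x, hXZ hx⟩ : W) = f ⟨x, hx⟩ := by
  obtain ⟨g, hg, hgf⟩ := exists_isometry_extending
    (B := LinearMap.BilinForm.restrict s Z) (B' := LinearMap.BilinForm.restrict s Z')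
    (i := Submodule.inclusion hXZ) (i' := Submodule.inclusion hXZ' ∘ₗ f)
    (fun x => hs x) (fun x => hs x) hdim
    (by rw [finrank_ker_restrict, finrank_ker_restrict, finrank_rad_eq hs hdim hZ hZ'])
    (fun x hx => by
      have : (x : W) ∈ X ⊓ rad s Z := ⟨x.2, (mem_ker_restrict_iff _).1 hx⟩
      rw [hX] at this
      exact Subtype.ext this)
    (fun x hx => by
      have : (f x : W) ∈ X' ⊓ rad s Z' := ⟨(f x).2, (mem_ker_restrict_iff _).1 hx⟩
      rw [hX'] at this
      exact f.map_eq_zero_iff.1 (Subtype.ext this))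
    (LinearMap.ext₂ fun x y => (hf x y).symm)
  exact ⟨g, hg, fun x hx => congrArg Subtype.val (hgf ⟨x, hx⟩)⟩

lemma le_of_incid {X Y : Submodule K W} (h : X ≠ Y → Incid s X Y)
    (hdim : finrank K X ≤ finrank K Y) : X ≤ Y := by
  by_cases hne : X = Y
  · exact hne.le
  obtain ⟨h, -⟩ | ⟨h, -⟩ := h hne
  · exact h
  · exact (Submodule.eq_of_le_of_finrank_le h hdim).ge

lemma inf_rad_eq_bot_of_incid {X Y : Submodule K W} (h : X ≠ Y → Incid s X Y)
    (hdim : finrank K X < finrank K Y) : X ⊓ rad s Y = ⊥ := by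
  obtain ⟨-, h⟩ | ⟨h, -⟩ := h (fun hXY => hdim.ne (by rw [hXY]))
  · exact h
  · exact absurd (Submodule.finrank_mono h) hdim.not_ge

/-- Members of the same dimension of two chains of the same type are isometric by a map
respecting all members of the chains. -/
lemma exists_isometry_of_chains (hs : ∀ v, s v v = 0) {C C' : Set (Submodule K W)}
    (hC : ∀ X ∈ C, finrank K (rad s X) ≤ 1) (hC' : ∀ X ∈ C', finrank K (rad s X) ≤ 1)
    (hi : ∀ X ∈ C, ∀ Y ∈ C, X ≠ Y → Incid s X Y)
    (hi' : ∀ X ∈ C', ∀ Y ∈ C', X ≠ Y → Incid s X Y)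
    (hbot : ⊥ ∈ C)
    (htype : ∀ X ∈ C, ∃ X' ∈ C', finrank K X = finrank K X')
    {Z Z' : Submodule K W} (hZ : Z ∈ C) (hZ' : Z' ∈ C') (hdim : finrank K Z = finrank K Z') :
    ∃ g : Z ≃ₗ[K] Z', (∀ x y : Z, s (g x) (g y) = s x y) ∧
      ∀ Y ∈ C, ∀ Y' ∈ C', finrank K Y = finrank K Y' → ∀ x : Z, (x : W) ∈ Y → (g x : W) ∈ Y' := by
  induction hn : finrank K Z using Nat.strong_induction_on generalizing Z Z' with
  | _ n ih =>
  obtain h0 | hpos := Nat.eq_zero_or_pos n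
  · have hZ0 : ∀ x : Z, x = 0 := by
      have : Z = ⊥ := Submodule.finrank_eq_zero.1 (hn.trans h0)
      subst this
      exact fun x => Subsingleton.elim _ _
    refine ⟨LinearEquiv.ofFinrankEq Z Z' hdim, fun x y => ?_, fun Y _ Y' _ _ x _ => ?_⟩ <;>
      simp [hZ0 x]
  · obtain ⟨m, ⟨X, hX, hXm, hmn⟩, hmax⟩ : ∃ m, Maximal
        (fun m => ∃ X ∈ C, finrank K X = m ∧ m < n) m :=
      Set.Finite.exists_maximal
        ((Set.finite_Iio n).subset fun m ⟨_, _, _, hm⟩ => hm) ⟨0, ⊥, hbot, finrank_bot K W, hpos⟩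
    obtain ⟨X', hX', hXX'⟩ := htype X hX
    obtain ⟨f, hf, hfC⟩ := ih m hmn hX hX' hXX' hXm
    have hlt : finrank K X < finrank K Z := by omega
    have hlt' : finrank K X' < finrank K Z' := by omega
    obtain ⟨g, hg, hgf⟩ := exists_isometry_extending_subspace hs
      (le_of_incid (hi X hX Z hZ) hlt.le) (le_of_incid (hi' X' hX' Z' hZ') hlt'.le)
      (inf_rad_eq_bot_of_incid (hi X hX Z hZ) hlt)
      (inf_rad_eq_bot_of_incid (hi' X' hX' Z' hZ') hlt') hdim (hC Z hZ) (hC' Z' hZ') f hf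
    refine ⟨g, hg, fun Y hY Y' hY' hYY' x hx => ?_⟩
    by_cases hYn : finrank K Y < n
    · have hYm : finrank K Y ≤ m := by
        by_contra hlt
        exact hlt (hmax ⟨Y, hY, rfl, hYn⟩ (not_le.1 hlt).le)
      have hxX : (x : W) ∈ X := le_of_incid (hi Y hY X hX) (hYm.trans hXm.ge) hx
      have := hgf x hxX
      rw [Subtype.coe_eta] at this
      rw [this]
      exact hfC Y hY Y' hY' hYY' ⟨x, hxX⟩ hx
    · exact le_of_incid (hi' Z' hZ' Y' hY') (by omega) (g x).2

end Restriction

/-- **`Sp(V)` acts flag-transitively on `Γ`: any two flags of the same type are conjugate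
under a linear automorphism of `V` preserving `s`.** -/
theorem flag_transitive (F V : Type) [Field F] [AddCommGroup V] [Module F V]
    [FiniteDimensional F V] (s : V →ₗ[F] V →ₗ[F] F) (hs : ∀ v, s v v = 0)
    (hrad : Module.finrank F ↥(rad s (⊤ : Submodule F V)) ≤ 1)
    (F1 F2 : Set (Submodule F V))
    (hF1o : ∀ X ∈ F1, IsObj s X) (hF1i : ∀ X ∈ F1, ∀ Y ∈ F1, X ≠ Y → Incid s X Y)
    (hF2o : ∀ X ∈ F2, IsObj s X) (hF2i : ∀ X ∈ F2, ∀ Y ∈ F2, X ≠ Y → Incid s X Y)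
    (htype : (fun X : Submodule F V => Module.finrank F ↥X) '' F1 =
             (fun X : Submodule F V => Module.finrank F ↥X) '' F2) :
    ∃ g : V ≃ₗ[F] V,
      (∀ v w : V, s (g v) (g w) = s v w) ∧
      (fun X : Submodule F V => Submodule.map (g : V →ₗ[F] V) X) '' F1 = F2 := by
  have hmem : ∀ C : Set (Submodule F V), ⊤ ∈ insert ⊥ (insert ⊤ C) := fun C => Or.inr (Or.inl rfl)
  obtain ⟨h, hh, hflag⟩ := exists_isometry_of_chains hs
    (finrank_rad_insert_bot_top hF1o hrad) (finrank_rad_insert_bot_top hF2o hrad)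
    (incid_insert_bot_top hF1o hF1i) (incid_insert_bot_top hF2o hF2i) (Or.inl rfl)
    (by
      rintro X (rfl | rfl | hX)
      · exact ⟨⊥, Or.inl rfl, rfl⟩
      · exact ⟨⊤, hmem F2, rfl⟩
      · obtain ⟨X', hX', hd⟩ := htype.subset ⟨X, hX, rfl⟩
        exact ⟨X', Or.inr (Or.inr hX'), hd.symm⟩)
    (hmem F1) (hmem F2) rfl
  let t := Submodule.topEquiv (R := F) (M := V)
  let g : V ≃ₗ[F] V := t.symm ≪≫ₗ h ≪≫ₗ t
  have hmap : ∀ X ∈ F1, ∀ X' ∈ F2, finrank F X = finrank F X' →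
      Submodule.map (g : V →ₗ[F] V) X = X' := by
    intro X hX X' hX' hd
    refine Submodule.eq_of_le_of_finrank_eq ?_ ((LinearEquiv.finrank_map_eq g X).trans hd)
    rintro _ ⟨x, hx, rfl⟩
    exact hflag X (Or.inr (Or.inr hX)) X' (Or.inr (Or.inr hX')) hd (t.symm x) hx
  refine ⟨g, fun v w => hh (t.symm v) (t.symm w), Set.Subset.antisymm ?_ ?_⟩
  · rintro _ ⟨X, hX, rfl⟩
    obtain ⟨X', hX', hd⟩ := htype.subset ⟨X, hX, rfl⟩
    exact (hmap X hX X' hX' hd.symm).symm.subst (motive := (· ∈ F2)) hX'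
  · intro X' hX'
    obtain ⟨X, hX, hd⟩ := htype.superset ⟨X', hX', rfl⟩
    exact ⟨X, hX, hmap X hX X' hX' hd⟩
end
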